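/- arXiv:2212.01438 — 2 statements merged into one kernel-verified Lean document; each statement's English description precedes it below -/
import Mathlib

section
/- Let A ∈ ℝ^{m×n} preserve Chebyshev systems and let u⁽ᵏ⁾, v⁽ᵏ⁾ be constructed by the alternating minimization method from an initial Chebyshev vector v⁽⁰⁾. Then ‖u⁽ᵏ⁾‖_∞ · ‖v⁽ᵏ⁻¹⁾‖_∞ ≤ 2‖A‖_C and ‖u⁽ᵏ⁾‖_∞ · ‖v⁽ᵏ⁾‖_∞ ≤ 2‖A‖_C for all k ≥ 1. -/
open Filter

/-- A vector is Chebyshev if all of its components are non-zero. -/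
def Cheb {n : ℕ} (v : Fin n → ℝ) : Prop := ∀ i, v i ≠ 0

/-- `mu a v` is the (unique, when `v` is Chebyshev) minimizer of `u ↦ ‖a - u • v‖`,
where `‖·‖` is the sup-norm on `Fin n → ℝ`. -/
noncomputable def mu {n : ℕ} (a v : Fin n → ℝ) : ℝ :=
  Classical.epsilon fun t : ℝ => ∀ u : ℝ, ‖a - t • v‖ ≤ ‖a - u • v‖

noncomputable def phi {m n : ℕ} (A : Fin m → Fin n → ℝ) (v : Fin n → ℝ) : Fin m → ℝ :=
  fun i => mu (A i) v

noncomputable def psi {m n : ℕ} (A : Fin m → Fin n → ℝ) (u : Fin m → ℝ) : Fin n → ℝ :=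
  fun j => mu (fun i => A i j) u

/-- `A` preserves Chebyshev systems. -/
def PreservesCheb {m n : ℕ} (A : Fin m → Fin n → ℝ) : Prop :=
  (∀ v : Fin n → ℝ, Cheb v → Cheb (phi A v)) ∧ (∀ u : Fin m → ℝ, Cheb u → Cheb (psi A u))

/-- A vector is alternance-free if exactly one component attains the max absolute value. -/
def AlternanceFree {n : ℕ} (a : Fin n → ℝ) : Prop := ∃! i, |a i| = ‖a‖

/-- Chebyshev norm of the residual `A - u vᵀ`. -/
noncomputable def Cerr {m n : ℕ} (A : Fin m → Fin n → ℝ) (u : Fin m → ℝ) (v : Fin n → ℝ) : ℝ :=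
  ⨆ i, ⨆ j, |A i j - u i * v j|

/-- Chebyshev norm of a matrix. -/
noncomputable def CnormM {m n : ℕ} (A : Fin m → Fin n → ℝ) : ℝ :=
  ⨆ i, ⨆ j, |A i j|

/-- The sequence `v⁽ᵏ⁾` of the alternating minimization method started at `v0`. -/
noncomputable def vseq {m n : ℕ} (A : Fin m → Fin n → ℝ) (v0 : Fin n → ℝ) : ℕ → Fin n → ℝ
  | 0 => v0
  | k + 1 => psi A (phi A (vseq A v0 k))

theorem mu_bound {n : ℕ} (a v : Fin n → ℝ) : |mu a v| * ‖v‖ ≤ 2 * ‖a‖ := by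
  by_cases hv : ‖v‖ = 0
  · rw [hv]; simp
  have hv' : 0 < ‖v‖ := lt_of_le_of_ne (norm_nonneg _) (Ne.symm hv)
  have hex : ∃ t : ℝ, ∀ u : ℝ, ‖a - t • v‖ ≤ ‖a - u • v‖ := by
    have hc : Continuous fun t : ℝ => ‖a - t • v‖ := by fun_prop
    refine hc.exists_forall_le ?_
    have h1 : Tendsto (fun t : ℝ => ‖t‖ * ‖v‖ + -‖a‖) (cocompact ℝ) atTop :=
      tendsto_atTop_add_const_right _ _ (tendsto_norm_cocompact_atTop.atTop_mul_const hv')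
    refine tendsto_atTop_mono (fun t => ?_) h1
    have := norm_sub_norm_le (t • v) a
    rw [norm_sub_rev, norm_smul] at this
    linarith
  have hmin : ∀ u : ℝ, ‖a - mu a v • v‖ ≤ ‖a - u • v‖ := Classical.epsilon_spec hex
  have h0 := hmin 0
  rw [zero_smul, sub_zero] at h0
  have := norm_sub_norm_le (mu a v • v) a
  rw [norm_sub_rev, norm_smul, Real.norm_eq_abs] at this
  linarith

theorem entry_le_CnormM {m n : ℕ} (A : Fin m → Fin n → ℝ) (i : Fin m) (j : Fin n) :
    |A i j| ≤ CnormM A :=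
  (le_ciSup (f := fun j => |A i j|) (Set.finite_range _).bddAbove j).trans
    (le_ciSup (f := fun i => ⨆ j, |A i j|) (Set.finite_range _).bddAbove i)

theorem CnormM_nonneg {m n : ℕ} (A : Fin m → Fin n → ℝ) : 0 ≤ CnormM A :=
  Real.iSup_nonneg fun _ => Real.iSup_nonneg fun _ => abs_nonneg _

theorem norm_mul_le_of_forall {m : ℕ} (u : Fin m → ℝ) (c B : ℝ) (hc : 0 ≤ c) (hB : 0 ≤ B)
    (h : ∀ i, |u i| * c ≤ B) : ‖u‖ * c ≤ B := by
  rcases hc.eq_or_lt with rfl | hc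
  · simpa using hB
  · rw [← le_div_iff₀ hc]
    refine (pi_norm_le_iff_of_nonneg (by positivity)).2 fun i => ?_
    rw [le_div_iff₀ hc]
    exact h i

theorem stmt9 {m n : ℕ} (hm : 2 ≤ m) (hn : 2 ≤ n) (A : Fin m → Fin n → ℝ)
    (hA : PreservesCheb A) (v0 : Fin n → ℝ) (hv0 : Cheb v0) (k : ℕ) :
    ‖phi A (vseq A v0 k)‖ * ‖vseq A v0 k‖ ≤ 2 * CnormM A ∧
      ‖phi A (vseq A v0 k)‖ * ‖vseq A v0 (k + 1)‖ ≤ 2 * CnormM A := by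
  have h0 := CnormM_nonneg A
  constructor
  · refine norm_mul_le_of_forall _ _ _ (norm_nonneg _) (by linarith) fun i => ?_
    refine (mu_bound _ _).trans ?_
    have : ‖A i‖ ≤ CnormM A := (pi_norm_le_iff_of_nonneg h0).2 fun j => entry_le_CnormM A i j
    linarith
  · rw [mul_comm]
    refine norm_mul_le_of_forall _ _ _ (norm_nonneg _) (by linarith) fun j => ?_
    refine (mu_bound (fun i => A i j) _).trans ?_
    have : ‖fun i => A i j‖ ≤ CnormM A :=
      (pi_norm_le_iff_of_nonneg h0).2 fun i => entry_le_CnormM A i j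
    linarith
end

section
/- Let A ∈ ℝ^{m×n} preserve Chebyshev systems and let v, ṽ ∈ ℝⁿ be Chebyshev vectors with sign(vⱼ) = sign(ṽⱼ) for all j. Then E(A, v) = E(A, ṽ): the limit error of the alternating minimization method depends only on the signs of the starting vector. -/
open Filter

open Topology

section helpers

theorem mu_exists {n : ℕ} (hn : 2 ≤ n) (a v : Fin n → ℝ) (hv : Cheb v) :
    ∃ t : ℝ, ∀ u : ℝ, ‖a - t • v‖ ≤ ‖a - u • v‖ := by
  have hv0 : v ≠ 0 := fun h => hv ⟨0, by omega⟩ (by rw [h]; rfl)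
  have hpos : 0 < ‖v‖ := norm_pos_iff.2 hv0
  have hc : Continuous fun u : ℝ => ‖a - u • v‖ := by fun_prop
  refine hc.exists_forall_le ?_
  have h1 : Tendsto (fun u : ℝ => ‖u‖ * ‖v‖ - ‖a‖) (cocompact ℝ) atTop := by
    refine tendsto_atTop_add_const_right _ _ ?_
    exact (tendsto_norm_cocompact_atTop (E := ℝ)).atTop_mul_const hpos
  refine tendsto_atTop_mono (fun u => ?_) h1
  have := norm_sub_norm_le (u • v) a
  rw [norm_smul] at this
  rw [norm_sub_rev a]
  exact this

theorem mu_spec {n : ℕ} (hn : 2 ≤ n) (a v : Fin n → ℝ) (hv : Cheb v) (u : ℝ) :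
    ‖a - mu a v • v‖ ≤ ‖a - u • v‖ :=
  Classical.epsilon_spec (mu_exists hn a v hv) u

theorem alt_pos {n : ℕ} (hn : 2 ≤ n) (a v : Fin n → ℝ) (hv : Cheb v) (t : ℝ)
    (ht : ∀ u : ℝ, ‖a - t • v‖ ≤ ‖a - u • v‖) :
    ∃ j, (a j - t * v j) * v j = ‖a - t • v‖ * |v j| := by
  by_contra! hcon
  set e := ‖a - t • v‖ with he
  have hle : ∀ j, |a j - t * v j| ≤ e := fun j => by
    have := norm_le_pi_norm (a - t • v) j
    simpa using this
  have hlt : ∀ j, (a j - t * v j) * v j < e * |v j| := fun j => by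
    refine lt_of_le_of_ne ?_ (hcon j)
    calc _ ≤ |(a j - t * v j) * v j| := le_abs_self _
      _ = |a j - t * v j| * |v j| := abs_mul _ _
      _ ≤ _ := mul_le_mul_of_nonneg_right (hle j) (abs_nonneg _)
  have hev : ∀ j, ∀ᶠ η : ℝ in 𝓝[>] 0, |a j - (t - η) * v j| < e := by
    intro j
    have hc : Tendsto (fun η : ℝ => a j - (t - η) * v j) (𝓝[>] 0) (𝓝 (a j - t * v j)) := by
      have : Continuous fun η : ℝ => a j - (t - η) * v j := by fun_prop
      have h := this.tendsto 0
      simp only [sub_zero] at h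
      exact h.mono_left nhdsWithin_le_nhds
    have h1 := hle j
    have h2 := hlt j
    rw [abs_le] at h1
    rcases lt_or_gt_of_ne (hv j) with h | h
    · rw [abs_of_neg h] at h2
      have h3 : -e < a j - t * v j := by nlinarith
      filter_upwards [hc.eventually_const_lt h3, self_mem_nhdsWithin] with η h4 h5
      have h5 : 0 < η := h5
      rw [abs_lt]
      refine ⟨h4, ?_⟩
      nlinarith
    · rw [abs_of_pos h] at h2
      have h3 : a j - t * v j < e := by nlinarith
      filter_upwards [hc.eventually_lt_const h3, self_mem_nhdsWithin] with η h4 h5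
      have h5 : 0 < η := h5
      rw [abs_lt]
      refine ⟨?_, h4⟩
      nlinarith
  obtain ⟨η, hη⟩ := (eventually_all.2 hev).exists
  have hepos : 0 < e := lt_of_le_of_lt (abs_nonneg _) (hη ⟨0, by omega⟩)
  have : ‖a - (t - η) • v‖ < e := by
    rw [pi_norm_lt_iff hepos]
    intro j
    simpa using hη j
  exact absurd (ht (t - η)) (not_le.2 this)

theorem alt_neg {n : ℕ} (hn : 2 ≤ n) (a v : Fin n → ℝ) (hv : Cheb v) (t : ℝ)
    (ht : ∀ u : ℝ, ‖a - t • v‖ ≤ ‖a - u • v‖) :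
    ∃ j, (a j - t * v j) * v j = - (‖a - t • v‖ * |v j|) := by
  obtain ⟨j, hj⟩ := alt_pos hn a (-v) (fun i => neg_ne_zero.2 (hv i)) (-t) (fun u => by
    have := ht (-u)
    simpa using this)
  refine ⟨j, ?_⟩
  simp at hj
  linarith

theorem mu_strong {n : ℕ} (hn : 2 ≤ n) (a v : Fin n → ℝ) (hv : Cheb v) (t : ℝ)
    (ht : ∀ u : ℝ, ‖a - t • v‖ ≤ ‖a - u • v‖) (c : ℝ) (hc : ∀ j, c ≤ |v j|) (s : ℝ) :
    ‖a - t • v‖ + c * |s - t| ≤ ‖a - s • v‖ := by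
  have key : ∀ j, |a j - s * v j| ≤ ‖a - s • v‖ := fun j => by
    simpa using norm_le_pi_norm (a - s • v) j
  rcases le_total s t with h | h
  · obtain ⟨j, hj⟩ := alt_pos hn a v hv t ht
    have hp := abs_pos.2 (hv j)
    have h1 : (a j - s * v j) * v j = (‖a - t • v‖ + |v j| * (t - s)) * |v j| := by
      have := abs_mul_abs_self (v j)
      linear_combination hj - (t - s) * this
    have h2 : (a j - s * v j) * v j ≤ |a j - s * v j| * |v j| := by
      rw [← abs_mul]; exact le_abs_self _
    rw [h1] at h2
    have h3 := le_of_mul_le_mul_right h2 hp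
    rw [abs_of_nonpos (by linarith)]
    nlinarith [key j, hc j]
  · obtain ⟨j, hj⟩ := alt_neg hn a v hv t ht
    have hp := abs_pos.2 (hv j)
    have h1 : (a j - s * v j) * v j = -((‖a - t • v‖ + |v j| * (s - t)) * |v j|) := by
      have := abs_mul_abs_self (v j)
      linear_combination hj - (t - s) * this
    have h2 : -((a j - s * v j) * v j) ≤ |a j - s * v j| * |v j| := by
      rw [← abs_mul]; exact neg_le_abs _
    rw [h1, neg_neg] at h2
    have h3 := le_of_mul_le_mul_right h2 hp
    rw [abs_of_nonneg (by linarith)]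
    nlinarith [key j, hc j]

theorem cheb_lower {n : ℕ} (hn : 2 ≤ n) (v : Fin n → ℝ) (hv : Cheb v) :
    ∃ c > 0, ∀ j, c ≤ |v j| := by
  have : Nonempty (Fin n) := ⟨⟨0, by omega⟩⟩
  obtain ⟨j, hj⟩ := Finite.exists_min (fun j => |v j|)
  exact ⟨|v j|, abs_pos.2 (hv j), hj⟩

theorem mu_unique {n : ℕ} (hn : 2 ≤ n) (a v : Fin n → ℝ) (hv : Cheb v) (s : ℝ)
    (hs : ‖a - s • v‖ ≤ ‖a - mu a v • v‖) : s = mu a v := by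
  obtain ⟨c, hc, hcv⟩ := cheb_lower hn v hv
  have := mu_strong hn a v hv _ (mu_spec hn a v hv) c hcv s
  have h : c * |s - mu a v| ≤ 0 := by linarith
  have h2 : |s - mu a v| ≤ 0 := by
    by_contra! h3
    nlinarith
  have := abs_nonpos_iff.1 h2
  linarith

theorem mu_smul {n : ℕ} (hn : 2 ≤ n) (a v : Fin n → ℝ) (hv : Cheb v) (c : ℝ) (hc : c ≠ 0) :
    mu a (c • v) = c⁻¹ * mu a v := by
  symm
  have hcv : Cheb (c • v) := fun j => by simpa using ⟨hc, hv j⟩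
  apply mu_unique hn a _ hcv
  have := mu_spec hn a v hv (mu a (c • v) * c)
  rw [smul_smul, smul_smul]
  rwa [mul_comm c⁻¹, mul_assoc, inv_mul_cancel₀ hc, mul_one]

theorem mu_continuousAt {n : ℕ} (hn : 2 ≤ n) (a v : Fin n → ℝ) (hv : Cheb v) :
    ContinuousAt (mu a) v := by
  obtain ⟨c, hc, hcv⟩ := cheb_lower hn v hv
  have hcheb : ∀ᶠ w in 𝓝 v, Cheb w := by
    refine eventually_all.2 fun j => ?_
    exact (continuous_apply j).continuousAt.eventually_ne (hv j)
  have hd : Tendsto (fun w => ‖w - v‖) (𝓝 v) (𝓝 0) := by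
    have : Continuous fun w : Fin n → ℝ => ‖w - v‖ := by fun_prop
    simpa using this.tendsto v
  have hsmall : ∀ᶠ w in 𝓝 v, ‖w - v‖ < c / 2 := hd.eventually_lt_const (by linarith)
  rw [ContinuousAt, tendsto_iff_dist_tendsto_zero]
  have hb : Tendsto (fun w => (4 * |mu a v| / c) * ‖w - v‖) (𝓝 v) (𝓝 0) := by
    simpa using hd.const_mul (4 * |mu a v| / c)
  refine tendsto_of_tendsto_of_tendsto_of_le_of_le' tendsto_const_nhds hb
    (Eventually.of_forall fun _ => dist_nonneg) ?_
  filter_upwards [hcheb, hsmall] with w hw hs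
  rw [Real.dist_eq]
  set t := mu a v
  set s := mu a w with hsdef
  have h1 := mu_strong hn a v hv _ (mu_spec hn a v hv) c hcv s
  have h2 := mu_spec hn a w hw t
  have h3 : ‖a - s • v‖ ≤ ‖a - s • w‖ + |s| * ‖w - v‖ := by
    have : a - s • v = (a - s • w) + s • (w - v) := by rw [smul_sub]; abel
    rw [this]
    refine (norm_add_le _ _).trans ?_
    rw [norm_smul, Real.norm_eq_abs]
  have h4 : ‖a - t • w‖ ≤ ‖a - t • v‖ + |t| * ‖w - v‖ := by
    have : a - t • w = (a - t • v) + (-t) • (w - v) := by rw [smul_sub, neg_smul, neg_smul]; abel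
    rw [this]
    refine (norm_add_le _ _).trans ?_
    rw [norm_smul, Real.norm_eq_abs, abs_neg]
  have h5 : |s| ≤ |s - t| + |t| := by
    have := abs_add_le (s - t) t
    simpa using this
  have h6 : c * |s - t| ≤ (|s| + |t|) * ‖w - v‖ := by
    change ‖a - t • v‖ + c * |s - t| ≤ _ at h1
    change ‖a - s • w‖ ≤ _ at h2
    linarith
  have h7 : c * |s - t| ≤ 4 * |t| * ‖w - v‖ := by
    nlinarith [mul_le_mul_of_nonneg_right h5 (norm_nonneg (w - v)),
      mul_le_mul_of_nonneg_left hs.le (abs_nonneg (s - t)), norm_nonneg (w - v)]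
  rw [div_mul_eq_mul_div, le_div_iff₀ hc]
  linarith

/-- Same signs. -/
theorem mu_sign {n : ℕ} (hn : 2 ≤ n) (a v w : Fin n → ℝ)
    (hs : ∀ j, 0 < v j * w j) (hne : ∀ z, Cheb z → mu a z ≠ 0) : 0 < mu a v * mu a w := by
  have hch : ∀ x ∈ Set.Icc (0 : ℝ) 1, Cheb (fun j => (1 - x) * v j + x * w j) := by
    intro x hx j h0
    have h1 := hs j
    obtain ⟨hx0, hx1⟩ := hx
    have hvj : v j ≠ 0 := fun h => by simp [h] at h1
    have hwj : w j ≠ 0 := fun h => by simp [h] at h1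
    have h2 := sq_pos_of_ne_zero hvj
    have : (1 - x) * (v j) ^ 2 + x * (v j * w j) = 0 := by
      linear_combination v j * h0
    rcases hx0.eq_or_lt with h | h
    · subst h; simp at this; exact hvj this
    · nlinarith [mul_pos h h1, mul_nonneg (sub_nonneg.2 hx1) h2.le]
  have hcont : ContinuousOn (fun x : ℝ => mu a (fun j => (1 - x) * v j + x * w j))
      (Set.Icc 0 1) := by
    intro x hx
    apply ContinuousAt.continuousWithinAt
    have hg : ContinuousAt (fun x : ℝ => (fun j => (1 - x) * v j + x * w j : Fin n → ℝ)) x := by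
      apply Continuous.continuousAt
      fun_prop
    exact ContinuousAt.comp (f := fun x : ℝ => (fun j => (1 - x) * v j + x * w j : Fin n → ℝ))
      (mu_continuousAt hn a _ (hch x hx)) hg
  have hv : Cheb v := fun j h => by have := hs j; simp [h] at this
  have hw : Cheb w := fun j h => by have := hs j; simp [h] at this
  have e0 : mu a (fun j => (1 - (0:ℝ)) * v j + 0 * w j) = mu a v := by simp
  have e1 : mu a (fun j => (1 - (1:ℝ)) * v j + 1 * w j) = mu a w := by simp
  by_contra! hcon
  have hnv := hne v hv
  have hnw := hne w hw
  have hz : (0 : ℝ) ∈ (fun x : ℝ => mu a (fun j => (1 - x) * v j + x * w j)) '' Set.Icc 0 1 := by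
    rcases lt_or_gt_of_ne hnv with h | h
    · apply intermediate_value_Icc zero_le_one hcont
      simp only [e0, e1]
      exact ⟨h.le, by by_contra! h'; nlinarith⟩
    · apply intermediate_value_Icc' zero_le_one hcont
      simp only [e0, e1]
      exact ⟨by by_contra! h'; nlinarith, h.le⟩
  obtain ⟨x, hx, hx0⟩ := hz
  exact hne _ (hch x hx) hx0

/-- Upper bound. -/
theorem mu_upper {n : ℕ} (hn : 2 ≤ n) (a v : Fin n → ℝ) (hv : Cheb v) :
    |mu a v| * ‖v‖ ≤ 2 * ‖a‖ := by
  have h := mu_spec hn a v hv 0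
  rw [zero_smul, sub_zero] at h
  have h2 := norm_sub_norm_le (mu a v • v) a
  rw [norm_smul, norm_sub_rev, Real.norm_eq_abs] at h2
  linarith

theorem exists_dominant {n : ℕ} (hn : 2 ≤ n) (a : Fin n → ℝ)
    (hne : ∀ z, Cheb z → mu a z ≠ 0) : ∃ p, ∀ j, j ≠ p → |a j| < |a p| := by
  have : Nonempty (Fin n) := ⟨⟨0, by omega⟩⟩
  obtain ⟨p, hp⟩ := Finite.exists_max (fun j => |a j|)
  refine ⟨p, fun q hq => ?_⟩
  by_contra! hcon
  have hpq : |a q| = |a p| := le_antisymm (hp q) hcon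
  -- a vector `z` with `mu a z = 0`
  let sg : ℝ → ℝ := fun x => if 0 ≤ x then 1 else -1
  have hsg : ∀ x, sg x ≠ 0 := fun x => by simp only [sg]; split_ifs <;> norm_num
  have hsgm : ∀ x, x = |x| * sg x := fun x => by
    simp only [sg]; split_ifs with h
    · rw [abs_of_nonneg h]; ring
    · rw [abs_of_neg (not_le.1 h)]; ring
  have hsgs : ∀ x, sg x * sg x = 1 := fun x => by simp only [sg]; split_ifs <;> norm_num
  let z : Fin n → ℝ := fun j => if j = p then sg (a p) else - sg (a j)
  have hz : Cheb z := fun j => by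
    simp only [z]; split_ifs
    · exact hsg _
    · exact neg_ne_zero.2 (hsg _)
  apply hne z hz
  symm
  apply mu_unique hn a z hz
  rw [zero_smul, sub_zero]
  set t := mu a z
  have hnorm : ‖a‖ ≤ |a p| := (pi_norm_le_iff_of_nonneg (abs_nonneg _)).2 hp
  refine hnorm.trans ?_
  have hkp : |a p - t * z p| ≤ ‖a - t • z‖ := by
    simpa using norm_le_pi_norm (a - t • z) p
  have hkq : |a q - t * z q| ≤ ‖a - t • z‖ := by
    simpa using norm_le_pi_norm (a - t • z) q
  have hzp : z p = sg (a p) := by simp [z]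
  have hzq : z q = - sg (a q) := by simp [z, hq]
  have abs_sg : ∀ x, |sg x| = 1 := fun x => by simp only [sg]; split_ifs <;> norm_num
  have e1 : |a p - t * z p| = |(|a p| - t)| := by
    have : a p - t * z p = (|a p| - t) * sg (a p) := by
      rw [hzp]; linear_combination hsgm (a p)
    rw [this, abs_mul, abs_sg, mul_one]
  have e2 : |a q - t * z q| = |(|a p| + t)| := by
    have : a q - t * z q = (|a p| + t) * sg (a q) := by
      rw [hzq]; linear_combination hsgm (a q) + sg (a q) * hpq
    rw [this, abs_mul, abs_sg, mul_one]
  rw [e1] at hkp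
  rw [e2] at hkq
  linarith [le_abs_self (|a p| - t), le_abs_self (|a p| + t)]

theorem mu_lower {n : ℕ} (hn : 2 ≤ n) (a : Fin n → ℝ)
    (hne : ∀ z, Cheb z → mu a z ≠ 0) : ∃ δ > 0, ∀ v, Cheb v → δ ≤ |mu a v| * ‖v‖ := by
  obtain ⟨p, hp⟩ := exists_dominant hn a hne
  have : Nontrivial (Fin n) := Fin.nontrivial_iff_two_le.2 hn
  obtain ⟨q0, hq0⟩ := exists_ne p
  have : Nonempty {j // j ≠ p} := ⟨⟨q0, hq0⟩⟩
  obtain ⟨⟨q, hq⟩, hqm⟩ := Finite.exists_max (fun j : {j // j ≠ p} => |a j|)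
  refine ⟨(|a p| - |a q|) / 2, by have := hp q hq; linarith, fun v hv => ?_⟩
  by_contra! hcon
  set t := mu a v
  have hb : ∀ j, |t * v j| ≤ |t| * ‖v‖ := fun j => by
    rw [abs_mul]
    exact mul_le_mul_of_nonneg_left (norm_le_pi_norm v j) (abs_nonneg _)
  have hp1 : |a p| - |t| * ‖v‖ ≤ |a p - t * v p| := by
    linarith [abs_sub_abs_le_abs_sub (a p) (t * v p), hb p]
  have hoth : ∀ j, j ≠ p → |a j - t * v j| < |a p - t * v p| := fun j hj => by
    have h1 := abs_sub (a j) (t * v j)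
    have h2 := hqm ⟨j, hj⟩
    simp only at h2
    linarith [hb j]
  have hpe : |a p - t * v p| ≤ ‖a - t • v‖ := by
    simpa using norm_le_pi_norm (a - t • v) p
  have hepos : 0 < ‖a - t • v‖ := lt_of_lt_of_le (lt_of_le_of_lt (abs_nonneg _) (hoth q hq)) hpe
  have uniq : ∀ j, |(a j - t * v j) * v j| = ‖a - t • v‖ * |v j| → j = p := by
    intro j hj
    by_contra hjp
    rw [abs_mul] at hj
    have := mul_right_cancel₀ (abs_pos.2 (hv j)).ne' hj
    have := hoth j hjp
    linarith
  obtain ⟨j, hj⟩ := alt_pos hn a v hv t (mu_spec hn a v hv)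
  obtain ⟨l, hl⟩ := alt_neg hn a v hv t (mu_spec hn a v hv)
  have hjp := uniq j (by rw [hj, abs_of_nonneg (by positivity)])
  have hlp := uniq l (by rw [hl, abs_neg, abs_of_nonneg (by positivity)])
  subst hjp
  subst hlp
  have := mul_pos hepos (abs_pos.2 (hv l))
  linarith

/-! ### The matrix level -/

variable {m n : ℕ}

/-- The residual norm as a product sup-norm. -/
noncomputable def resN (A : Fin m → Fin n → ℝ) (u : Fin m → ℝ) (v : Fin n → ℝ) : ℝ :=
  ‖(fun i j => A i j - u i * v j : Fin m → Fin n → ℝ)‖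

theorem resN_nonneg (A : Fin m → Fin n → ℝ) (u : Fin m → ℝ) (v : Fin n → ℝ) :
    0 ≤ resN A u v := norm_nonneg _

theorem resN_le_iff (A : Fin m → Fin n → ℝ) (u : Fin m → ℝ) (v : Fin n → ℝ) {r : ℝ}
    (hr : 0 ≤ r) : resN A u v ≤ r ↔ ∀ i j, |A i j - u i * v j| ≤ r := by
  unfold resN
  rw [pi_norm_le_iff_of_nonneg hr]
  refine forall_congr' fun i => ?_
  rw [pi_norm_le_iff_of_nonneg hr]
  rfl

theorem le_resN (A : Fin m → Fin n → ℝ) (u : Fin m → ℝ) (v : Fin n → ℝ) (i j) :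
    |A i j - u i * v j| ≤ resN A u v :=
  (resN_le_iff A u v (resN_nonneg A u v)).1 le_rfl i j

theorem Cerr_eq (hm : 2 ≤ m) (hn : 2 ≤ n) (A : Fin m → Fin n → ℝ) (u : Fin m → ℝ)
    (v : Fin n → ℝ) : Cerr A u v = resN A u v := by
  have : Nonempty (Fin n) := ⟨⟨0, by omega⟩⟩
  have : Nonempty (Fin m) := ⟨⟨0, by omega⟩⟩
  unfold Cerr
  apply le_antisymm
  · exact ciSup_le fun i => ciSup_le fun j => le_resN A u v i j
  · have key : ∀ i j, |A i j - u i * v j| ≤ ⨆ i, ⨆ j, |A i j - u i * v j| := fun i j =>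
      (le_ciSup (f := fun j => |A i j - u i * v j|) (Set.finite_range _).bddAbove j).trans
        (le_ciSup (f := fun i => ⨆ j, |A i j - u i * v j|) (Set.finite_range _).bddAbove i)
    rw [resN_le_iff]
    · exact key
    · exact (abs_nonneg _).trans (key ⟨0, by omega⟩ ⟨0, by omega⟩)

theorem row_le_resN (A : Fin m → Fin n → ℝ) (u : Fin m → ℝ) (v : Fin n → ℝ) (i) :
    ‖A i - u i • v‖ ≤ resN A u v := by
  rw [pi_norm_le_iff_of_nonneg (resN_nonneg A u v)]
  intro j
  simpa using le_resN A u v i j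

theorem col_le_resN (A : Fin m → Fin n → ℝ) (u : Fin m → ℝ) (v : Fin n → ℝ) (j) :
    ‖(fun i => A i j) - v j • u‖ ≤ resN A u v := by
  rw [pi_norm_le_iff_of_nonneg (resN_nonneg A u v)]
  intro i
  simpa [mul_comm] using le_resN A u v i j

theorem resN_psi_le (hm : 2 ≤ m) (A : Fin m → Fin n → ℝ) (u : Fin m → ℝ) (hu : Cheb u)
    (v : Fin n → ℝ) : resN A u (psi A u) ≤ resN A u v := by
  rw [resN_le_iff _ _ _ (resN_nonneg A u v)]
  intro i j
  have h1 := mu_spec hm (fun i => A i j) u hu (v j)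
  have h2 := norm_le_pi_norm ((fun i => A i j) - mu (fun i => A i j) u • u) i
  have h3 := col_le_resN A u v j
  simp at h2
  rw [mul_comm]
  exact h2.trans (h1.trans h3)

/-- Key step. -/
theorem active_step (hm : 2 ≤ m) (hn : 2 ≤ n) (A : Fin m → Fin n → ℝ)
    (v0 v1 : Fin n → ℝ) (u0 u1 : Fin m → ℝ) (hu0 : u0 = phi A v0) (hv1 : v1 = psi A u0)
    (hu1 : u1 = phi A v1) (hcu0 : Cheb u0) (hcv1 : Cheb v1)
    (E : ℝ) (hE0 : resN A u0 v0 = E) (i : Fin m) (hi : ‖A i - u1 i • v1‖ = E) :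
    ‖A i - u0 i • v0‖ = E ∧ ∃ j i', ‖A i' - u0 i' • v0‖ = E ∧
      (A i j - u0 i * v1 j) * (u0 i * v1 j) = E * |u0 i * v1 j| ∧
      (A i' j - u0 i' * v1 j) * (u0 i' * v1 j) = -(E * |u0 i' * v1 j|) := by
  have hEn : 0 ≤ E := hE0 ▸ resN_nonneg _ _ _
  have h01 : resN A u0 v1 ≤ E := by
    rw [hv1, ← hE0]; exact resN_psi_le hm A u0 hcu0 v0
  have hmu : u1 i = mu (A i) v1 := by rw [hu1]; rfl
  have hui : u0 i = u1 i := by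
    rw [hmu]
    apply mu_unique hn _ _ hcv1
    rw [← hmu, hi]
    exact (row_le_resN A u0 v1 i).trans h01
  have hmin : ∀ s : ℝ, ‖A i - u0 i • v1‖ ≤ ‖A i - s • v1‖ := by
    rw [hui, hmu]; exact mu_spec hn _ _ hcv1
  have hi' : ‖A i - u0 i • v1‖ = E := by rw [hui]; exact hi
  -- the entry (i,j)
  have hj : ∃ j, (A i j - u0 i * v1 j) * (u0 i * v1 j) = E * |u0 i * v1 j| := by
    rcases lt_or_gt_of_ne (hcu0 i) with h | h
    · obtain ⟨j, hj⟩ := alt_neg hn _ _ hcv1 _ hmin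
      refine ⟨j, ?_⟩
      rw [hi'] at hj
      rw [abs_mul, abs_of_neg h]
      linear_combination u0 i * hj
    · obtain ⟨j, hj⟩ := alt_pos hn _ _ hcv1 _ hmin
      refine ⟨j, ?_⟩
      rw [hi'] at hj
      rw [abs_mul, abs_of_pos h]
      linear_combination u0 i * hj
  obtain ⟨j, hj⟩ := hj
  have absE : ∀ k, |(A k j - u0 k * v1 j) * (u0 k * v1 j)| = E * |u0 k * v1 j| →
      |A k j - u0 k * v1 j| = E := by
    intro k hk
    rw [abs_mul] at hk
    exact mul_right_cancel₀ (abs_pos.2 (mul_ne_zero (hcu0 k) (hcv1 j))).ne' hk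
  have hij : |A i j - u0 i * v1 j| = E := absE i (by rw [hj, abs_of_nonneg (by positivity)])
  have hmuj : v1 j = mu (fun k => A k j) u0 := by rw [hv1]; rfl
  have hcol : ‖(fun k => A k j) - v1 j • u0‖ = E := by
    apply le_antisymm ((col_le_resN A u0 v1 j).trans h01)
    have := norm_le_pi_norm ((fun k => A k j) - v1 j • u0) i
    simp [mul_comm (v1 j)] at this
    rwa [hij] at this
  have hvj : v0 j = v1 j := by
    rw [hmuj]
    apply mu_unique hm _ _ hcu0
    rw [← hmuj, hcol, ← hE0]
    exact col_le_resN A u0 v0 j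
  have hminj : ∀ s : ℝ, ‖(fun k => A k j) - v1 j • u0‖ ≤ ‖(fun k => A k j) - s • u0‖ := by
    rw [hmuj]; exact mu_spec hm _ _ hcu0
  have hk : ∃ k, (A k j - u0 k * v1 j) * (u0 k * v1 j) = -(E * |u0 k * v1 j|) := by
    rcases lt_or_gt_of_ne (hcv1 j) with h | h
    · obtain ⟨k, hk⟩ := alt_pos hm _ _ hcu0 _ hminj
      refine ⟨k, ?_⟩
      rw [hcol] at hk
      rw [abs_mul, abs_of_neg h]
      linear_combination v1 j * hk
    · obtain ⟨k, hk⟩ := alt_neg hm _ _ hcu0 _ hminj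
      refine ⟨k, ?_⟩
      rw [hcol] at hk
      rw [abs_mul, abs_of_pos h]
      linear_combination v1 j * hk
  obtain ⟨k, hk⟩ := hk
  have hkj : |A k j - u0 k * v1 j| = E :=
    absE k (by rw [hk, abs_neg, abs_of_nonneg (by positivity)])
  have fin : ∀ k, |A k j - u0 k * v1 j| = E → ‖A k - u0 k • v0‖ = E := by
    intro k hk
    apply le_antisymm (hE0 ▸ row_le_resN A u0 v0 k)
    have := norm_le_pi_norm (A k - u0 k • v0) j
    simp [hvj] at this
    rwa [hk] at this
  exact ⟨fin i hij, j, k, fin k hkj, hj, hk⟩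

theorem vseq_cheb (A : Fin m → Fin n → ℝ) (hA : PreservesCheb A) (v : Fin n → ℝ) (hv : Cheb v)
    (k : ℕ) : Cheb (vseq A v k) := by
  induction k with
  | zero => exact hv
  | succ k ih => exact hA.2 _ (hA.1 _ ih)

theorem exists_active_row (hm : 2 ≤ m) (A : Fin m → Fin n → ℝ) (u : Fin m → ℝ) (v : Fin n → ℝ) :
    ∃ i, ‖A i - u i • v‖ = resN A u v := by
  have : Nonempty (Fin m) := ⟨⟨0, by omega⟩⟩
  obtain ⟨i, hi⟩ := Finite.exists_max (fun i => ‖A i - u i • v‖)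
  refine ⟨i, le_antisymm (row_le_resN A u v i) ?_⟩
  rw [resN_le_iff _ _ _ (norm_nonneg _)]
  intro k j
  have := norm_le_pi_norm (A k - u k • v) j
  simp at this
  exact this.trans (hi k)

/-- The certificate. -/
theorem certificate (hm : 2 ≤ m) (hn : 2 ≤ n) (A : Fin m → Fin n → ℝ) (hA : PreservesCheb A)
    (v : Fin n → ℝ) (hv : Cheb v) (E : ℝ)
    (hE : ∀ s, resN A (phi A (vseq A v s)) (vseq A v s) = E) :
    ∃ K, ∀ x y, (∀ i, 0 < x i * phi A (vseq A v K) i) → (∀ j, 0 < y j * vseq A v (K + 1) j) →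
      E ≤ resN A x y := by
  classical
  let S : ℕ → Finset (Fin m) := fun s =>
    Finset.univ.filter fun i => ‖A i - phi A (vseq A v s) i • vseq A v s‖ = E
  have hstep := fun s (i : Fin m) (hi : i ∈ S (s + 1)) =>
    active_step hm hn A (vseq A v s) (vseq A v (s + 1)) _ _ rfl rfl rfl
      (hA.1 _ (vseq_cheb A hA v hv s)) (vseq_cheb A hA v hv (s + 1)) E (hE s) i
      (Finset.mem_filter.1 hi).2
  have hsub : ∀ s, S (s + 1) ⊆ S s := fun s i hi =>
    Finset.mem_filter.2 ⟨Finset.mem_univ _, (hstep s i hi).1⟩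
  have hmin : ∃ K, ∀ s, (S K).card ≤ (S s).card := by
    exact ⟨Function.argmin (fun s => (S s).card), fun s => Function.argmin_le (fun s => (S s).card) s⟩
  obtain ⟨K, hK⟩ := hmin
  have heq : S (K + 1) = S K := Finset.eq_of_subset_of_card_le (hsub K) (hK _)
  refine ⟨K, fun x y hx hy => ?_⟩
  by_contra! hlt
  have hne : (S (K + 1)).Nonempty := by
    obtain ⟨i, hi⟩ := exists_active_row hm A (phi A (vseq A v (K + 1))) (vseq A v (K + 1))
    exact ⟨i, Finset.mem_filter.2 ⟨Finset.mem_univ _, hi.trans (hE _)⟩⟩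
  set u := phi A (vseq A v K) with hu
  set z := vseq A v (K + 1) with hz
  obtain ⟨i, hi, himin⟩ := Finset.exists_min_image (S (K + 1)) (fun i => x i / u i) hne
  obtain ⟨-, j, k, hk, h1, h2⟩ := hstep K i hi
  have hkS : k ∈ S (K + 1) := by
    rw [heq]; exact Finset.mem_filter.2 ⟨Finset.mem_univ _, hk⟩
  have hle := himin k hkS
  change (A i j - u i * z j) * (u i * z j) = E * |u i * z j| at h1
  change (A k j - u k * z j) * (u k * z j) = -(E * |u k * z j|) at h2
  have hxi := hx i
  have hxk := hx k
  have hyj := hy j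
  have b1 := (le_resN A x y i j).trans_lt hlt
  have b2 := (le_resN A x y k j).trans_lt hlt
  -- ratios
  have hui : u i ≠ 0 := fun h => by rw [h] at hxi; simp at hxi
  have huk : u k ≠ 0 := fun h => by rw [h] at hxk; simp at hxk
  have hzj : z j ≠ 0 := fun h => by rw [h] at hyj; simp at hyj
  set r := x i / u i with hr
  set r' := x k / u k with hr'
  set q := y j / z j with hq
  have ex : x i = r * u i := by rw [hr]; field_simp
  have ek : x k = r' * u k := by rw [hr']; field_simp
  have ey : y j = q * z j := by rw [hq]; field_simp
  have hqp : 0 < q := by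
    rw [ey] at hyj
    by_contra! h
    nlinarith [mul_self_nonneg (z j)]
  have c1 : 1 < r * q := by
    have hP : u i * z j ≠ 0 := mul_ne_zero hui hzj
    have hPp := abs_pos.2 hP
    have ha : (A i j - x i * y j) * (u i * z j) < E * |u i * z j| := by
      refine (le_abs_self _).trans_lt ?_
      rw [abs_mul]
      exact mul_lt_mul_of_pos_right b1 hPp
    rw [ex, ey] at ha
    have : 0 < (r * q - 1) * (u i * z j) ^ 2 := by nlinarith
    have := pos_of_mul_pos_left this (sq_nonneg _)
    linarith
  have c2 : r' * q < 1 := by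
    have hP : u k * z j ≠ 0 := mul_ne_zero huk hzj
    have hPp := abs_pos.2 hP
    have ha : -((A k j - x k * y j) * (u k * z j)) < E * |u k * z j| := by
      refine (neg_le_abs _).trans_lt ?_
      rw [abs_mul]
      exact mul_lt_mul_of_pos_right b2 hPp
    rw [ek, ey] at ha
    have : 0 < (1 - r' * q) * (u k * z j) ^ 2 := by nlinarith
    have := pos_of_mul_pos_left this (sq_nonneg _)
    linarith
  have : r * q ≤ r' * q := mul_le_mul_of_nonneg_right hle hqp.le
  linarith

theorem phi_smul (hn : 2 ≤ n) (A : Fin m → Fin n → ℝ) (v : Fin n → ℝ) (hv : Cheb v) (c : ℝ)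
    (hc : c ≠ 0) : phi A (c • v) = c⁻¹ • phi A v := by
  funext i; exact mu_smul hn _ _ hv c hc

theorem psi_smul (hm : 2 ≤ m) (A : Fin m → Fin n → ℝ) (u : Fin m → ℝ) (hu : Cheb u) (c : ℝ)
    (hc : c ≠ 0) : psi A (c • u) = c⁻¹ • psi A u := by
  funext i; exact mu_smul hm _ _ hu c hc

theorem vseq_smul (hm : 2 ≤ m) (hn : 2 ≤ n) (A : Fin m → Fin n → ℝ) (hA : PreservesCheb A)
    (v : Fin n → ℝ) (hv : Cheb v) (c : ℝ) (hc : c ≠ 0) (s : ℕ) :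
    vseq A (c • v) s = c • vseq A v s := by
  induction s with
  | zero => rfl
  | succ s ih =>
    have h := vseq_cheb A hA v hv s
    simp only [vseq]
    rw [ih, phi_smul hn A _ h c hc, psi_smul hm A _ (hA.1 _ h) _ (inv_ne_zero hc), inv_inv]

theorem vseq_add (A : Fin m → Fin n → ℝ) (v : Fin n → ℝ) (k s : ℕ) :
    vseq A (vseq A v k) s = vseq A v (k + s) := by
  induction s with
  | zero => rfl
  | succ s ih => rw [← add_assoc]; simp only [vseq]; rw [ih]

theorem phi_continuousAt (hn : 2 ≤ n) (A : Fin m → Fin n → ℝ) (v : Fin n → ℝ) (hv : Cheb v) :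
    ContinuousAt (phi A) v :=
  continuousAt_pi.2 fun i => mu_continuousAt hn (A i) v hv

theorem psi_continuousAt (hm : 2 ≤ m) (A : Fin m → Fin n → ℝ) (u : Fin m → ℝ) (hu : Cheb u) :
    ContinuousAt (psi A) u :=
  continuousAt_pi.2 fun j => mu_continuousAt hm (fun i => A i j) u hu

theorem vseq_continuousAt (hm : 2 ≤ m) (hn : 2 ≤ n) (A : Fin m → Fin n → ℝ)
    (hA : PreservesCheb A) (v : Fin n → ℝ) (hv : Cheb v) (s : ℕ) :
    ContinuousAt (fun v => vseq A v s) v := by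
  induction s with
  | zero => exact continuousAt_id
  | succ s ih =>
    have h := vseq_cheb A hA v hv s
    have h1 : ContinuousAt (fun v => phi A (vseq A v s)) v :=
      ContinuousAt.comp (f := fun v => vseq A v s) (phi_continuousAt hn A _ h) ih
    exact ContinuousAt.comp (f := fun v => phi A (vseq A v s))
      (psi_continuousAt hm A _ (hA.1 _ h)) h1

theorem resN_continuous (A : Fin m → Fin n → ℝ) :
    Continuous fun p : (Fin m → ℝ) × (Fin n → ℝ) => resN A p.1 p.2 := by
  unfold resN
  fun_prop

theorem resN_smul (A : Fin m → Fin n → ℝ) (u : Fin m → ℝ) (v : Fin n → ℝ) (c : ℝ) (hc : c ≠ 0) :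
    resN A (c⁻¹ • u) (c • v) = resN A u v := by
  unfold resN
  congr 1
  funext i j
  simp only [Pi.smul_apply, smul_eq_mul]
  field_simp

theorem signs (hm : 2 ≤ m) (hn : 2 ≤ n) (A : Fin m → Fin n → ℝ) (hA : PreservesCheb A)
    (v w : Fin n → ℝ) (hs : ∀ j, 0 < v j * w j) :
    (∀ i, 0 < phi A v i * phi A w i) ∧
      ∀ s, ∀ j, 0 < vseq A v s j * vseq A w s j := by
  have hphi : ∀ v w : Fin n → ℝ, (∀ j, 0 < v j * w j) → ∀ i, 0 < phi A v i * phi A w i :=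
    fun v w h i => mu_sign hn (A i) v w h fun z hz => hA.1 z hz i
  refine ⟨hphi v w hs, fun s => ?_⟩
  induction s with
  | zero => exact hs
  | succ s ih =>
    intro j
    exact mu_sign hm (fun i => A i j) _ _ (hphi _ _ ih) fun z hz => hA.2 z hz j

theorem half (hm : 2 ≤ m) (hn : 2 ≤ n) (A : Fin m → Fin n → ℝ)
    (hA : PreservesCheb A) (v w : Fin n → ℝ) (hv : Cheb v) (hw : Cheb w)
    (hs : ∀ j, 0 < v j * w j) (E₁ E₂ : ℝ)
    (h₁ : Tendsto (fun k => resN A (phi A (vseq A v k)) (vseq A v k)) atTop (𝓝 E₁))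
    (h₂ : Tendsto (fun k => resN A (phi A (vseq A w k)) (vseq A w k)) atTop (𝓝 E₂)) :
    E₁ ≤ E₂ := by
  have : Nonempty (Fin n) := ⟨⟨0, by omega⟩⟩
  have : Nonempty (Fin m) := ⟨⟨0, by omega⟩⟩
  have hlow := fun j => mu_lower hm (fun i => A i j) fun z hz => hA.2 z hz j
  choose δ hδ hδl using hlow
  let c : ℕ → ℝ := fun k => ‖phi A (vseq A v k)‖
  have hcu : ∀ k, Cheb (phi A (vseq A v k)) := fun k => hA.1 _ (vseq_cheb A hA v hv k)
  have hc : ∀ k, 0 < c k := fun k => norm_pos_iff.2 fun h => hcu k ⟨0, by omega⟩ (by rw [h]; rfl)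
  let z : ℕ → Fin n → ℝ := fun k => c k • vseq A v (k + 1)
  have hzl : ∀ k j, δ j ≤ |z k j| := fun k j => by
    have := hδl j _ (hcu k)
    simp only [z, Pi.smul_apply, smul_eq_mul, abs_mul, abs_of_pos (hc k)]
    rw [mul_comm]
    exact this
  let R : Fin n → ℝ := fun j => 2 * ‖fun i => A i j‖
  have hzu : ∀ k j, |z k j| ≤ R j := fun k j => by
    have := mu_upper hm (fun i => A i j) _ (hcu k)
    simp only [z, Pi.smul_apply, smul_eq_mul, abs_mul, abs_of_pos (hc k)]
    rw [mul_comm]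
    exact this
  have hbox : ∀ k, z k ∈ Set.Icc (-R) R := fun k =>
    ⟨fun j => (abs_le.1 (hzu k j)).1, fun j => (abs_le.1 (hzu k j)).2⟩
  obtain ⟨zs, -, φ, hφ, hlim⟩ := (isCompact_Icc (a := -R) (b := R)).tendsto_subseq hbox
  have hzs : Cheb zs := fun j h0 => by
    have h1 : Tendsto (fun k => |z (φ k) j|) atTop (𝓝 |zs j|) :=
      ((tendsto_pi_nhds.1 hlim) j).abs
    have h2 := ge_of_tendsto' h1 fun k => hzl (φ k) j
    rw [h0, abs_zero] at h2
    linarith [hδ j]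
  have hconst : ∀ s, resN A (phi A (vseq A zs s)) (vseq A zs s) = E₁ := by
    intro s
    have a1 : Tendsto (fun k => vseq A (z (φ k)) s) atTop (𝓝 (vseq A zs s)) :=
      (vseq_continuousAt hm hn A hA zs hzs s).tendsto.comp hlim
    have a2 : Tendsto (fun k => phi A (vseq A (z (φ k)) s)) atTop (𝓝 (phi A (vseq A zs s))) :=
      (phi_continuousAt hn A _ (vseq_cheb A hA zs hzs s)).tendsto.comp a1
    have a3 := ((resN_continuous A).tendsto _).comp (a2.prodMk_nhds a1)
    have a4 : Tendsto (fun k => φ k + 1 + s) atTop atTop :=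
      tendsto_atTop_mono (fun k => by have := hφ.id_le k; simp only [id] at this ⊢; omega) tendsto_id
    have a5 := h₁.comp a4
    refine tendsto_nhds_unique a3 (a5.congr fun k => ?_)
    have hcv := vseq_cheb A hA v hv
    simp only [Function.comp, z]
    rw [vseq_smul hm hn A hA _ (hcv _) _ (hc _).ne', vseq_add,
      phi_smul hn A _ (hcv _) _ (hc _).ne', resN_smul _ _ _ _ (hc _).ne']
  obtain ⟨K, hK⟩ := certificate hm hn A hA zs hzs E₁ hconst
  have hev : ∀ᶠ k in atTop, ∀ j, 0 < z (φ k) j * zs j := by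
    refine eventually_all.2 fun j => ?_
    have : Tendsto (fun k => z (φ k) j * zs j) atTop (𝓝 (zs j * zs j)) :=
      ((tendsto_pi_nhds.1 hlim) j).mul_const _
    exact this.eventually_const_lt (mul_self_pos.2 (hzs j))
  have hvw := (signs hm hn A hA v w hs).2
  have a4 : Tendsto (fun k => φ k + 1 + K) atTop atTop :=
    tendsto_atTop_mono (fun k => by have := hφ.id_le k; simp only [id] at this ⊢; omega) tendsto_id
  refine ge_of_tendsto (h₂.comp a4) ?_
  filter_upwards [hev] with k hk
  have hwz : ∀ j, 0 < vseq A w (φ k + 1) j * zs j := by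
    intro j
    have h1 := hk j
    have h2 := hvw (φ k + 1) j
    simp only [z, Pi.smul_apply, smul_eq_mul] at h1
    have h3 : 0 < vseq A v (φ k + 1) j * zs j := by
      rw [mul_assoc] at h1
      exact pos_of_mul_pos_right h1 (hc _).le
    have h4 := mul_pos h2 h3
    have h5 : 0 < (vseq A w (φ k + 1) j * zs j) * (vseq A v (φ k + 1) j) ^ 2 := by
      linarith
    exact pos_of_mul_pos_left h5 (sq_nonneg _)
  have hsg := (signs hm hn A hA _ zs hwz).2
  have hsgK := (signs hm hn A hA _ _ (hsg K)).1
  have hfin := hK (phi A (vseq A w (φ k + 1 + K))) (vseq A w (φ k + 1 + K + 1))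
    (by rw [← vseq_add]; exact hsgK)
    (by rw [add_assoc, ← vseq_add]; exact hsg (K + 1))
  exact hfin.trans (resN_psi_le hm A _ (hA.1 _ (vseq_cheb A hA w hw _)) _)

end helpers

theorem stmt18 {m n : ℕ} (hm : 2 ≤ m) (hn : 2 ≤ n) (A : Fin m → Fin n → ℝ)
    (hA : PreservesCheb A) (v w : Fin n → ℝ) (hv : Cheb v) (hw : Cheb w)
    (hs : ∀ j, Real.sign (v j) = Real.sign (w j)) (E₁ E₂ : ℝ)
    (h₁ : Filter.Tendsto (fun k => Cerr A (phi A (vseq A v k)) (vseq A v k)) atTop (nhds E₁))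
    (h₂ : Filter.Tendsto (fun k => Cerr A (phi A (vseq A w k)) (vseq A w k)) atTop (nhds E₂)) :
    E₁ = E₂ := by
  simp only [Cerr_eq hm hn] at h₁ h₂
  have hpos : ∀ j, 0 < v j * w j := by
    intro j
    have h := hs j
    rcases lt_or_gt_of_ne (hv j) with h1 | h1 <;> rcases lt_or_gt_of_ne (hw j) with h2 | h2
    · exact mul_pos_of_neg_of_neg h1 h2
    · rw [Real.sign_of_neg h1, Real.sign_of_pos h2] at h; norm_num at h
    · rw [Real.sign_of_pos h1, Real.sign_of_neg h2] at h; norm_num at h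
    · exact mul_pos h1 h2
  exact le_antisymm (half hm hn A hA v w hv hw hpos E₁ E₂ h₁ h₂)
    (half hm hn A hA w v hw hv (fun j => by rw [mul_comm]; exact hpos j) E₂ E₁ h₂ h₁)
end
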